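/- arXiv:1405.3423 — 3 statements merged into one kernel-verified Lean document; each statement's English description precedes it below -/
import Mathlib

section
/- For every integer m ≥ 1, as x → ∞ along the positive reals, Γ*(x) − Σ_{n=0}^{m−1} (−1)^n γ_n x^{−n} = O(x^{−m}); that is, the scaled gamma function has the asymptotic expansion Γ*(x) ∼ Σ_{n≥0} (−1)^n γ_n x^{−n}. -/
open Finset Filter Asymptotics

/-- The function `φ(t) = (t²/(2(eᵗ − t − 1)))^{1/2}` for `t ≠ 0`, with `φ(0) = 1`. -/
noncomputable def phi (t : ℝ) : ℝ :=
  if t = 0 then 1 else Real.sqrt (t ^ 2 / (2 * (Real.exp t - t - 1)))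

/-- The Stirling coefficients `γ₀ = 1` and
`γₙ = ((−1)ⁿ/(2ⁿ n!)) · D^{2n}[φ^{2n+1}](0)` for `n ≥ 1`. -/
noncomputable def stirlingGamma (n : ℕ) : ℝ :=
  if n = 0 then 1
  else ((-1) ^ n / (2 ^ n * n.factorial)) *
    iteratedDeriv (2 * n) (fun t => phi t ^ (2 * n + 1)) 0

/-- The scaled gamma function `Γ*(x) = Γ(x) / (√(2π) x^{x−1/2} e^{−x})`. -/
noncomputable def GammaStar (x : ℝ) : ℝ :=
  Real.Gamma x / (Real.sqrt (2 * Real.pi) * x ^ (x - 1 / 2) * Real.exp (-x))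

/-- The entire function `2 (e^z - z - 1) / z²`. -/
noncomputable def Psi (z : ℂ) : ℂ :=
  if z = 0 then 1 else 2 * (Complex.exp z - z - 1) / z ^ 2

theorem Psi_mul_sq (z : ℂ) : Psi z * z ^ 2 = 2 * (Complex.exp z - z - 1) := by
  unfold Psi
  split_ifs with h
  · simp [h]
  · field_simp

theorem norm_Psi_sub_one_le {z : ℂ} (hz : ‖z‖ ≤ 1) : ‖Psi z - 1‖ ≤ ‖z‖ / 2 := by
  unfold Psi
  split_ifs with h
  · simp [h]
  · have h1 := Complex.exp_bound hz (n := 3) (by norm_num)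
    have h2 : 2 * (Complex.exp z - z - 1) / z ^ 2 - 1
        = 2 * (Complex.exp z - ∑ m ∈ range 3, z ^ m / (m.factorial : ℂ)) / z ^ 2 := by
      simp [Finset.sum_range_succ, Nat.factorial]
      field_simp
      ring
    have h0 : 0 < ‖z‖ := norm_pos_iff.2 h
    rw [h2, norm_div, norm_mul, norm_pow, div_le_iff₀ (by positivity)]
    norm_num [Nat.factorial] at h1 ⊢
    nlinarith [pow_pos h0 3]

theorem differentiable_Psi : Differentiable ℂ Psi := by
  rw [← differentiableOn_univ,
    ← Complex.differentiableOn_compl_singleton_and_continuousAt_iff (c := 0) univ_mem]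
  constructor
  · have : DifferentiableOn ℂ (fun z : ℂ => 2 * (Complex.exp z - z - 1) / z ^ 2)
        (Set.univ \ {0}) := by
      intro z hz
      have hz : z ≠ 0 := by simpa using hz
      have hn : DifferentiableAt ℂ (fun z : ℂ => 2 * (Complex.exp z - z - 1)) z := by fun_prop
      have hd : DifferentiableAt ℂ (fun z : ℂ => z ^ 2) z := by fun_prop
      exact (hn.fun_div hd (pow_ne_zero 2 hz)).differentiableWithinAt
    refine this.congr fun z hz => ?_
    have hz : z ≠ 0 := by simpa using hz
    simp [Psi, hz]
  · have h0 : Psi 0 = 1 := if_pos rfl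
    have hlim : Tendsto (fun z : ℂ => ‖z‖ / 2) (nhds 0) (nhds 0) := by
      have : Continuous fun z : ℂ => ‖z‖ / 2 := by fun_prop
      simpa using this.tendsto 0
    have hlim' : Tendsto Psi (nhds 0) (nhds 1) := by
      rw [tendsto_iff_norm_sub_tendsto_zero]
      refine squeeze_zero' (Eventually.of_forall fun _ => norm_nonneg _) ?_ hlim
      filter_upwards [Metric.closedBall_mem_nhds (0 : ℂ) one_pos] with z hz
      exact norm_Psi_sub_one_le (by simpa using hz)
    rwa [← h0] at hlim'

theorem half_le_re_Psi {z : ℂ} (hz : ‖z‖ ≤ 1) : 1 / 2 ≤ (Psi z).re := by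
  have h1 := norm_Psi_sub_one_le hz
  have h2 := (abs_le.1 (Complex.abs_re_le_norm (Psi z - 1))).1
  simp at h2
  linarith

/-- The Gaussian `exp(-Ψ(z) u² / 2)`. -/
noncomputable def gaussPsi (u : ℝ) (z : ℂ) : ℂ := Complex.exp (-(Psi z / 2) * (u : ℂ) ^ 2)

theorem differentiable_gaussPsi (u : ℝ) : Differentiable ℂ (gaussPsi u) := by
  have := differentiable_Psi
  unfold gaussPsi
  fun_prop

theorem continuous_gaussPsi : Continuous fun p : ℝ × ℂ => gaussPsi p.1 p.2 := by
  have := differentiable_Psi.continuous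
  unfold gaussPsi
  fun_prop

theorem norm_gaussPsi_le (u : ℝ) {z : ℂ} (hz : ‖z‖ ≤ 1) :
    ‖gaussPsi u z‖ ≤ Real.exp (-u ^ 2 / 4) := by
  unfold gaussPsi
  rw [norm_cexp_neg_mul_sq, Real.exp_le_exp]
  have := half_le_re_Psi hz
  simp
  nlinarith [sq_nonneg u]

theorem exp_neg_sq_div_four_le (u : ℝ) :
    Real.exp (-u ^ 2 / 4) ≤ 3 * Real.exp (-|u| / 8) := by
  have h1 : Real.exp (-u ^ 2 / 4) ≤ Real.exp (1 + -|u| / 8) := by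
    rw [Real.exp_le_exp]
    nlinarith [sq_nonneg (|u| / 2 - 1), sq_abs u, abs_nonneg u]
  rw [Real.exp_add] at h1
  nlinarith [Real.exp_one_lt_d9, Real.exp_pos (-|u| / 8)]

theorem integrable_abs_pow_mul_exp_neg_abs (N : ℕ) :
    MeasureTheory.Integrable fun u : ℝ => |u| ^ N * Real.exp (-|u| / 8) := by
  refine (integrable_inv_one_add_sq.const_mul
    (8 ^ N * N.factorial + 8 ^ (N + 2) * (N + 2).factorial : ℝ)).mono'
    (by fun_prop) (Eventually.of_forall fun u => ?_)
  rw [Real.norm_of_nonneg (by positivity), neg_div, Real.exp_neg, ← div_eq_mul_inv,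
    ← div_eq_mul_inv, div_le_div_iff₀ (by positivity) (by positivity)]
  have key (k : ℕ) : |u| ^ k ≤ 8 ^ k * k.factorial * Real.exp (|u| / 8) := by
    have := Real.pow_div_factorial_le_exp (|u| / 8) (by positivity) k
    rw [div_pow, div_div, div_le_iff₀ (by positivity)] at this
    linarith
  have h1 := key N
  have h2 := key (N + 2)
  rw [pow_add, sq_abs] at h2
  linarith

theorem integrable_pow_mul_of_norm_le {f : ℝ → ℂ} {C : ℝ} (N : ℕ)
    (hf : MeasureTheory.AEStronglyMeasurable f)
    (hC : ∀ u, ‖f u‖ ≤ C * Real.exp (-|u| / 8)) :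
    MeasureTheory.Integrable fun u : ℝ => (u : ℂ) ^ N * f u := by
  refine ((integrable_abs_pow_mul_exp_neg_abs N).const_mul C).mono'
    (.mul (by fun_prop) hf) (Eventually.of_forall fun u => ?_)
  rw [norm_mul, norm_pow, Complex.norm_real, Real.norm_eq_abs]
  have := mul_le_mul_of_nonneg_left (hC u) (pow_nonneg (abs_nonneg u) N)
  linarith

theorem norm_iteratedDeriv_div_factorial_le {F : ℂ → ℂ} (hF : Differentiable ℂ F) {B : ℝ}
    (hB : ∀ z, ‖z‖ ≤ 1 → ‖F z‖ ≤ B) (k : ℕ) : ‖iteratedDeriv k F 0 / k.factorial‖ ≤ B := by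
  have := Complex.norm_iteratedDeriv_le_of_forall_mem_sphere_norm_le k one_pos hF.diffContOnCl
    (fun z hz => hB z (mem_sphere_zero_iff_norm.1 hz).le)
  rw [norm_div, Complex.norm_natCast, div_le_iff₀ (by positivity)]
  simpa [mul_comm] using this

theorem norm_sub_taylor_le {F : ℂ → ℂ} (hF : Differentiable ℂ F) {B : ℝ}
    (hB : ∀ z, ‖z‖ ≤ 1 → ‖F z‖ ≤ B) (N : ℕ) {h : ℂ} (hh : ‖h‖ ≤ 1 / 2) :
    ‖F h - ∑ k ∈ range N, iteratedDeriv k F 0 / k.factorial * h ^ k‖ ≤ 2 * B * ‖h‖ ^ N := by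
  have hs := Complex.hasSum_taylorSeries_on_ball (f := F) (c := 0) (r := 1) hF.differentiableOn
    (z := h) (by simp; linarith)
  have hs' : HasSum (fun k => iteratedDeriv k F 0 / k.factorial * h ^ k) (F h) := by
    refine hs.congr_fun fun k => ?_
    simp only [sub_zero, smul_eq_mul]
    ring
  have hcoef (k : ℕ) : ‖iteratedDeriv k F 0 / k.factorial‖ ≤ B :=
    norm_iteratedDeriv_div_factorial_le hF hB k
  have hterm (k : ℕ) : ‖iteratedDeriv (k + N) F 0 / (k + N).factorial * h ^ (k + N)‖
      ≤ B * ‖h‖ ^ N * (1 / 2) ^ k := by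
    rw [norm_mul, norm_pow, pow_add, mul_comm (‖h‖ ^ k), ← mul_assoc]
    have hB0 : 0 ≤ B := (norm_nonneg _).trans (hcoef 0)
    gcongr
    exact hcoef _
  rw [← ((hasSum_nat_add_iff' N).2 hs').tsum_eq]
  refine (tsum_of_norm_bounded (hasSum_geometric_two.mul_left (B * ‖h‖ ^ N)) hterm).trans_eq ?_
  ring

theorem integrable_pow_mul_gaussian {b : ℂ} (hb : 0 < b.re) (n : ℕ) :
    MeasureTheory.Integrable (fun u : ℝ => (u : ℂ) ^ n * Complex.exp (-b * (u : ℂ) ^ 2)) := by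
  have h := integrable_rpow_mul_exp_neg_mul_sq hb (s := n)
    (neg_one_lt_zero.trans_le n.cast_nonneg)
  refine h.mono (by fun_prop) (Eventually.of_forall fun u => ?_)
  rw [norm_mul, norm_mul, norm_cexp_neg_mul_sq, Real.norm_of_nonneg (Real.exp_pos _).le]
  simp

theorem integral_even_pow_mul_gaussian {b : ℂ} (hb : 0 < b.re) (n : ℕ) :
    ∫ u : ℝ, (u : ℂ) ^ (2 * n) * Complex.exp (-b * (u : ℂ) ^ 2)
      = (2 * n).factorial / (2 ^ n * n.factorial) * (2 * b)⁻¹ ^ n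
        * (Real.pi / b) ^ (1 / 2 : ℂ) := by
  have hb0 : b ≠ 0 := by rintro rfl; simp at hb
  induction n with
  | zero => simpa using integral_gaussian_complex hb
  | succ n ih =>
    have hd (u : ℝ) : HasDerivAt
        (fun u : ℝ => (u : ℂ) ^ (2 * n + 1) * Complex.exp (-b * (u : ℂ) ^ 2))
        ((2 * n + 1) * ((u : ℂ) ^ (2 * n) * Complex.exp (-b * (u : ℂ) ^ 2))
          - 2 * b * ((u : ℂ) ^ (2 * (n + 1)) * Complex.exp (-b * (u : ℂ) ^ 2))) u := by
      have h1 : HasDerivAt (fun z : ℂ => z ^ (2 * n + 1) * Complex.exp (-b * z ^ 2)) _ (u : ℂ) :=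
        (hasDerivAt_pow (2 * n + 1) (u : ℂ)).mul
          (((hasDerivAt_pow 2 (u : ℂ)).const_mul (-b)).cexp)
      convert h1.comp_ofReal using 1
      push_cast
      simp
      ring
    have hi1 := (integrable_pow_mul_gaussian hb (2 * n)).const_mul (2 * n + 1 : ℂ)
    have hi2 := (integrable_pow_mul_gaussian hb (2 * (n + 1))).const_mul (2 * b)
    have h0 := MeasureTheory.integral_eq_zero_of_hasDerivAt_of_integrable hd
      (hi1.sub hi2) (integrable_pow_mul_gaussian hb (2 * n + 1))
    rw [MeasureTheory.integral_sub hi1 hi2, MeasureTheory.integral_const_mul,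
      MeasureTheory.integral_const_mul, ih, sub_eq_zero] at h0
    have h2 := eq_div_of_mul_eq (mul_ne_zero two_ne_zero hb0) ((mul_comm _ _).trans h0.symm)
    rw [h2]
    have e : ((2 * (n + 1)).factorial : ℂ) = (2 * n + 2) * (2 * n + 1) * (2 * n).factorial := by
      rw [show 2 * (n + 1) = 2 * n + 1 + 1 by ring, Nat.factorial_succ, Nat.factorial_succ]
      push_cast; ring
    rw [e, Nat.factorial_succ, pow_succ, pow_succ]
    have : (n : ℂ) + 1 ≠ 0 := Nat.cast_add_one_ne_zero n
    have h3 : (n.factorial : ℂ) ≠ 0 := Nat.cast_ne_zero.2 n.factorial_ne_zero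
    push_cast
    field_simp

theorem iteratedDeriv_ofReal_eq {F : ℂ → ℂ} {f : ℝ → ℝ}
    (hF : DifferentiableOn ℂ F (Metric.ball 0 1))
    (hf : ∀ t : ℝ, |t| < 1 → (f t : ℂ) = F t) (k : ℕ) :
    ∀ t : ℝ, |t| < 1 → ((iteratedDeriv k f t : ℝ) : ℂ) = iteratedDeriv k F t := by
  have hdiff (k : ℕ) : DifferentiableOn ℂ (iteratedDeriv k F) (Metric.ball 0 1) := by
    induction k with
    | zero => simpa using hF
    | succ k ih =>
      rw [iteratedDeriv_succ]
      exact ih.deriv Metric.isOpen_ball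
  induction k with
  | zero => simpa using hf
  | succ k ih =>
    intro t ht
    have hmem : (t : ℂ) ∈ Metric.ball (0 : ℂ) 1 := by simpa using ht
    have hd := ((hdiff k).differentiableAt (Metric.isOpen_ball.mem_nhds hmem)).hasDerivAt
    have hev : ∀ᶠ s : ℝ in nhds t, |s| < 1 := (continuous_abs.tendsto t).eventually_lt_const ht
    have h1 : HasDerivAt (iteratedDeriv k f) (deriv (iteratedDeriv k F) t).re t := by
      refine hd.real_of_complex.congr_of_eventuallyEq ?_
      filter_upwards [hev] with s hs
      rw [← ih s hs, Complex.ofReal_re]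
    have h2 := h1.ofReal_comp
    have h3 : HasDerivAt (fun s : ℝ => ((iteratedDeriv k f s : ℝ) : ℂ))
        (deriv (iteratedDeriv k F) t) t := by
      refine hd.comp_ofReal.congr_of_eventuallyEq ?_
      filter_upwards [hev] with s hs using ih s hs
    rw [iteratedDeriv_succ, iteratedDeriv_succ, h1.deriv]
    exact h2.unique h3

/-- The holomorphic extension of `phi` to the unit disc. -/
noncomputable def phiC (z : ℂ) : ℂ :=
  (Real.pi / (Psi z / 2)) ^ (1 / 2 : ℂ) / (Real.sqrt (2 * Real.pi) : ℝ)

theorem re_pi_div_pos {b : ℂ} (hb : 0 < b.re) : 0 < ((Real.pi : ℂ) / b).re := by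
  have hb0 : b ≠ 0 := by rintro rfl; simp at hb
  have := Complex.normSq_pos.2 hb0
  rw [Complex.div_re]
  simp
  have := Real.pi_pos
  positivity

theorem re_Psi_div_two_pos {z : ℂ} (hz : ‖z‖ ≤ 1) : 0 < (Psi z / 2).re := by
  have := half_le_re_Psi hz
  simp
  linarith

theorem differentiableOn_phiC : DifferentiableOn ℂ phiC (Metric.closedBall 0 1) := by
  intro z hz
  have hb := re_Psi_div_two_pos (z := z) (by simpa using hz)
  have hb0 : Psi z / 2 ≠ 0 := by intro h; simp [h] at hb
  have h1 : DifferentiableAt ℂ (fun z => Psi z / 2) z := (differentiable_Psi z).div_const 2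
  have h2 : DifferentiableAt ℂ (fun z => (Real.pi : ℂ) / (Psi z / 2)) z :=
    (differentiableAt_const _).fun_div h1 hb0
  exact ((h2.cpow_const (Or.inl (re_pi_div_pos hb))).div_const _).differentiableWithinAt

theorem sqrt_two_pi_ne_zero : ((Real.sqrt (2 * Real.pi) : ℝ) : ℂ) ≠ 0 := by
  have := Real.pi_pos
  exact Complex.ofReal_ne_zero.2 (by positivity)

theorem phiC_sq {z : ℂ} (hz : ‖z‖ ≤ 1) : phiC z ^ 2 = (2 * (Psi z / 2))⁻¹ := by
  have hb := re_Psi_div_two_pos hz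
  have hb0 : Psi z ≠ 0 := by intro h; simp [h] at hb
  have h1 : (((Real.pi : ℂ) / (Psi z / 2)) ^ (1 / 2 : ℂ)) ^ 2 = (Real.pi : ℂ) / (Psi z / 2) := by
    rw [one_div]
    exact_mod_cast Complex.cpow_nat_inv_pow ((Real.pi : ℂ) / (Psi z / 2)) two_ne_zero
  have hpi : (Real.pi : ℂ) ≠ 0 := Complex.ofReal_ne_zero.2 Real.pi_ne_zero
  rw [phiC, div_pow, h1, ← Complex.ofReal_pow, Real.sq_sqrt (by positivity)]
  push_cast
  field_simp

theorem integral_even_pow_mul_gaussPsi {z : ℂ} (hz : ‖z‖ ≤ 1) (n : ℕ) :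
    ∫ u : ℝ, (u : ℂ) ^ (2 * n) * gaussPsi u z
      = (2 * n).factorial / (2 ^ n * n.factorial) * (Real.sqrt (2 * Real.pi) : ℝ)
        * phiC z ^ (2 * n + 1) := by
  have h := integral_even_pow_mul_gaussian (re_Psi_div_two_pos hz) n
  rw [← phiC_sq hz] at h
  unfold gaussPsi
  have h1 : (Real.pi / (Psi z / 2)) ^ (1 / 2 : ℂ) = (Real.sqrt (2 * Real.pi) : ℝ) * phiC z :=
    (mul_div_cancel₀ _ sqrt_two_pi_ne_zero).symm
  rw [h, h1]
  ring

theorem phi_eq_phiC {t : ℝ} (ht : |t| < 1) : (phi t : ℂ) = phiC t := by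
  have hz : ‖(t : ℂ)‖ ≤ 1 := by simpa using ht.le
  have key : ∃ p : ℝ, Psi t = p ∧ phi t = Real.sqrt p⁻¹ := by
    by_cases h : t = 0
    · exact ⟨1, by simp [Psi, h], by simp [phi, h]⟩
    · refine ⟨2 * (Real.exp t - t - 1) / t ^ 2, by simp [Psi, h], ?_⟩
      rw [phi, if_neg h, inv_div]
  obtain ⟨p, h1, h2⟩ := key
  have hp : 0 < p := by
    have := half_le_re_Psi hz
    rw [h1, Complex.ofReal_re] at this
    linarith
  have hpi := Real.pi_pos
  have h3 : ((Real.pi : ℂ) / (Psi t / 2)) ^ (1 / 2 : ℂ) = (Real.sqrt (Real.pi / (p / 2)) : ℝ) := by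
    rw [h1, Real.sqrt_eq_rpow, Complex.ofReal_cpow (by positivity)]
    push_cast
    rfl
  rw [phiC, h3, ← Complex.ofReal_div, ← Real.sqrt_div' _ (by positivity), h2]
  congr 2
  field_simp

theorem stirlingGamma_eq (n : ℕ) : (((-1) ^ n * stirlingGamma n : ℝ) : ℂ)
    = iteratedDeriv (2 * n) (fun z => phiC z ^ (2 * n + 1)) 0 / (2 ^ n * n.factorial) := by
  have h := iteratedDeriv_ofReal_eq (F := fun z => phiC z ^ (2 * n + 1))
    (f := fun t => phi t ^ (2 * n + 1))
    ((differentiableOn_phiC.mono Metric.ball_subset_closedBall).fun_pow _)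
    (fun t ht => by rw [Complex.ofReal_pow, phi_eq_phiC ht]) (2 * n) 0 (by simp)
  rw [Complex.ofReal_zero] at h
  rw [← h]
  have h1 : (-1 : ℝ) ^ n * stirlingGamma n
      = iteratedDeriv (2 * n) (fun t => phi t ^ (2 * n + 1)) 0 / (2 ^ n * n.factorial) := by
    unfold stirlingGamma
    split_ifs with h0
    · subst h0
      simp [phi]
    · rw [← mul_assoc, mul_div_assoc', ← mul_pow]
      norm_num
      ring
  rw [h1]
  push_cast
  rfl

theorem circleIntegral_gaussPsi (k : ℕ) (u : ℝ) :
    ∫ θ in (0 : ℝ)..2 * Real.pi, circleMap 0 1 θ * Complex.I *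
        (1 / circleMap 0 1 θ ^ (k + 1) * gaussPsi u (circleMap 0 1 θ))
      = 2 * Real.pi * Complex.I * (iteratedDeriv k (gaussPsi u) 0 / k.factorial) := by
  have h := (differentiable_gaussPsi u).differentiableOn.circleIntegral_one_div_sub_center_pow_smul
    (c := 0) one_pos k
  simp only [circleIntegral, deriv_circleMap, sub_zero, smul_eq_mul] at h
  rw [h]
  ring

theorem continuous_circle_integrand (k : ℕ) : Continuous fun p : ℝ × ℝ =>
    circleMap 0 1 p.2 * Complex.I *
      (1 / circleMap 0 1 p.2 ^ (k + 1) * gaussPsi p.1 (circleMap 0 1 p.2)) := by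
  have h1 : Continuous fun p : ℝ × ℝ => circleMap 0 1 p.2 :=
    (continuous_circleMap 0 1).comp continuous_snd
  have h2 : Continuous fun p : ℝ × ℝ => gaussPsi p.1 (circleMap 0 1 p.2) :=
    continuous_gaussPsi.comp (continuous_fst.prodMk h1)
  have h3 (p : ℝ × ℝ) : circleMap 0 1 p.2 ^ (k + 1) ≠ 0 :=
    pow_ne_zero _ (circleMap_ne_center one_ne_zero)
  exact (h1.mul continuous_const).mul ((continuous_const.div (h1.pow _) h3).mul h2)

theorem continuous_iteratedDeriv_gaussPsi (k : ℕ) :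
    Continuous fun u : ℝ => iteratedDeriv k (gaussPsi u) 0 / k.factorial := by
  have h := intervalIntegral.continuous_parametric_intervalIntegral_of_continuous'
    (μ := MeasureTheory.volume)
    (f := fun u θ : ℝ => circleMap 0 1 θ * Complex.I *
      (1 / circleMap 0 1 θ ^ (k + 1) * gaussPsi u (circleMap 0 1 θ)))
    (continuous_circle_integrand k) 0 (2 * Real.pi)
  simp only [circleIntegral_gaussPsi] at h
  have h2 := h.const_mul (2 * Real.pi * Complex.I : ℂ)⁻¹
  simpa only [inv_mul_cancel_left₀ Complex.two_pi_I_ne_zero] using h2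

theorem norm_iteratedDeriv_gaussPsi_le (k : ℕ) (u : ℝ) :
    ‖iteratedDeriv k (gaussPsi u) 0 / k.factorial‖ ≤ 3 * Real.exp (-|u| / 8) :=
  (norm_iteratedDeriv_div_factorial_le (differentiable_gaussPsi u)
    (fun _ hz => norm_gaussPsi_le u hz) k).trans (exp_neg_sq_div_four_le u)

theorem integrable_pow_mul_iteratedDeriv_gaussPsi (k : ℕ) : MeasureTheory.Integrable fun u : ℝ =>
    (u : ℂ) ^ k * (iteratedDeriv k (gaussPsi u) 0 / k.factorial) :=
  integrable_pow_mul_of_norm_le k (continuous_iteratedDeriv_gaussPsi k).aestronglyMeasurable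
    (norm_iteratedDeriv_gaussPsi_le k)

theorem integral_odd_pow_mul_iteratedDeriv_gaussPsi (n : ℕ) :
    ∫ u : ℝ, (u : ℂ) ^ (2 * n + 1) *
      (iteratedDeriv (2 * n + 1) (gaussPsi u) 0 / (2 * n + 1).factorial) = 0 := by
  have h := MeasureTheory.integral_neg_eq_self (fun u : ℝ => (u : ℂ) ^ (2 * n + 1) *
      (iteratedDeriv (2 * n + 1) (gaussPsi u) 0 / (2 * n + 1).factorial)) MeasureTheory.volume
  have h1 (u : ℝ) : gaussPsi (-u) = gaussPsi u := by
    ext z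
    simp [gaussPsi]
  have h2 (u : ℝ) : ((-u : ℝ) : ℂ) ^ (2 * n + 1) = -(u : ℂ) ^ (2 * n + 1) := by
    rw [Complex.ofReal_neg, Odd.neg_pow ⟨n, rfl⟩]
  simp only [h1, h2, neg_mul, MeasureTheory.integral_neg] at h
  exact self_eq_neg.1 h.symm

theorem integral_even_pow_mul_iteratedDeriv_gaussPsi (n : ℕ) :
    ∫ u : ℝ, (u : ℂ) ^ (2 * n) * (iteratedDeriv (2 * n) (gaussPsi u) 0 / (2 * n).factorial)
      = (Real.sqrt (2 * Real.pi) : ℝ) * ((-1) ^ n * stirlingGamma n : ℝ) := by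
  have : MeasureTheory.IsFiniteMeasure
      (MeasureTheory.volume.restrict (Set.uIoc 0 (2 * Real.pi))) := ⟨by simp [Set.uIoc]⟩
  have hnorm (θ : ℝ) : ‖circleMap 0 1 θ‖ = 1 := by simp
  have hint : MeasureTheory.Integrable (Function.uncurry fun θ u : ℝ =>
      (u : ℂ) ^ (2 * n) * (circleMap 0 1 θ * Complex.I *
        (1 / circleMap 0 1 θ ^ (2 * n + 1) * gaussPsi u (circleMap 0 1 θ))))
      ((MeasureTheory.volume.restrict (Set.uIoc 0 (2 * Real.pi))).prod MeasureTheory.volume) := by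
    refine (((integrable_abs_pow_mul_exp_neg_abs (2 * n)).const_mul 3).comp_snd _).mono' ?_ ?_
    · have h1 : Continuous fun p : ℝ × ℝ => (p.2 : ℂ) ^ (2 * n) := by fun_prop
      have h2 := (continuous_circle_integrand (2 * n)).comp continuous_swap
      simp only [Function.comp_def, Prod.fst_swap, Prod.snd_swap] at h2
      exact (h1.mul h2).aestronglyMeasurable
    · refine Eventually.of_forall fun p => ?_
      have h1 := (norm_gaussPsi_le p.2 (hnorm p.1).le).trans (exp_neg_sq_div_four_le p.2)
      have h2 := mul_le_mul_of_nonneg_left h1 (pow_nonneg (abs_nonneg p.2) (2 * n))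
      simp only [Function.uncurry, norm_mul, norm_div, norm_pow, hnorm, Complex.norm_I,
        Complex.norm_real, Real.norm_eq_abs, norm_one, one_pow, div_one, one_mul]
      linarith
  have hswap := MeasureTheory.intervalIntegral_integral_swap hint
  simp only [intervalIntegral.integral_const_mul, circleIntegral_gaussPsi] at hswap
  have hin (θ : ℝ) : ∫ u : ℝ, (u : ℂ) ^ (2 * n) * (circleMap 0 1 θ * Complex.I *
        (1 / circleMap 0 1 θ ^ (2 * n + 1) * gaussPsi u (circleMap 0 1 θ)))
      = ((2 * n).factorial / (2 ^ n * n.factorial) * (Real.sqrt (2 * Real.pi) : ℝ)) *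
        (circleMap 0 1 θ * Complex.I * (1 / circleMap 0 1 θ ^ (2 * n + 1)
          * phiC (circleMap 0 1 θ) ^ (2 * n + 1))) := by
    have h1 (u : ℝ) : (u : ℂ) ^ (2 * n) * (circleMap 0 1 θ * Complex.I *
        (1 / circleMap 0 1 θ ^ (2 * n + 1) * gaussPsi u (circleMap 0 1 θ)))
      = (circleMap 0 1 θ * Complex.I * (1 / circleMap 0 1 θ ^ (2 * n + 1)))
        * ((u : ℂ) ^ (2 * n) * gaussPsi u (circleMap 0 1 θ)) := by ring
    simp only [h1, MeasureTheory.integral_const_mul,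
      integral_even_pow_mul_gaussPsi (hnorm θ).le n]
    ring
  simp only [hin, intervalIntegral.integral_const_mul] at hswap
  have h := (differentiableOn_phiC.fun_pow (2 * n + 1)).circleIntegral_one_div_sub_center_pow_smul
    one_pos (2 * n)
  simp only [circleIntegral, deriv_circleMap, sub_zero, smul_eq_mul] at h
  rw [h] at hswap
  have hf : ((2 * n).factorial : ℂ) ≠ 0 := Nat.cast_ne_zero.2 (Nat.factorial_ne_zero _)
  refine mul_left_cancel₀ Complex.two_pi_I_ne_zero ?_
  rw [stirlingGamma_eq, ← MeasureTheory.integral_const_mul]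
  simp only [mul_left_comm (2 * Real.pi * Complex.I : ℂ)]
  rw [← hswap]
  field_simp

theorem abs_div_eight_le_exp_sub {h : ℝ} (hh : 1 / 2 ≤ |h|) :
    |h| / 8 ≤ Real.exp h - h - 1 := by
  rcases le_abs.1 hh with h0 | h0
  · rw [abs_of_nonneg (by linarith)]
    nlinarith [Real.quadratic_le_exp_of_nonneg (x := h) (by linarith)]
  · rw [abs_of_nonpos (by linarith)]
    by_cases h2 : h ≤ -2
    · linarith [Real.exp_pos h]
    · have h1 := Real.add_one_le_exp (h / 2)
      have h3 : Real.exp h = Real.exp (h / 2) * Real.exp (h / 2) := by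
        rw [← Real.exp_add]
        ring_nf
      rw [h3]
      nlinarith

theorem gaussPsi_mul {ε : ℝ} (hε : ε ≠ 0) (u : ℝ) : gaussPsi u ((ε * u : ℝ) : ℂ)
    = (Real.exp (-(Real.exp (ε * u) - ε * u - 1) / ε ^ 2) : ℝ) := by
  have h := Psi_mul_sq ((ε * u : ℝ) : ℂ)
  have hε' : (ε : ℂ) ≠ 0 := Complex.ofReal_ne_zero.2 hε
  unfold gaussPsi
  push_cast at h ⊢
  congr 1
  field_simp
  linear_combination (-1 : ℂ) * h

theorem norm_gaussPsi_mul_le {ε : ℝ} (hε : 0 < ε) (hε1 : ε ≤ 1) {u : ℝ}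
    (hu : 1 / 2 ≤ |ε * u|) : ‖gaussPsi u ((ε * u : ℝ) : ℂ)‖ ≤ Real.exp (-|u| / 8) := by
  rw [gaussPsi_mul hε.ne', Complex.norm_real, Real.norm_of_nonneg (Real.exp_pos _).le,
    Real.exp_le_exp, div_le_iff₀ (by positivity)]
  have h1 := abs_div_eight_le_exp_sub hu
  rw [abs_mul, abs_of_pos hε] at h1
  nlinarith [mul_nonneg (mul_nonneg hε.le (abs_nonneg u)) (sub_nonneg.2 hε1)]

theorem norm_gaussPsi_mul_sub_taylor_le {ε : ℝ} (hε : 0 < ε) (hε1 : ε ≤ 1) (N : ℕ) (u : ℝ) :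
    ‖gaussPsi u ((ε * u : ℝ) : ℂ) - ∑ k ∈ range N, (ε : ℂ) ^ k *
        ((u : ℂ) ^ k * (iteratedDeriv k (gaussPsi u) 0 / k.factorial))‖
      ≤ ε ^ N * (6 + 2 ^ N * (1 + 3 * N)) * (|u| ^ N * Real.exp (-|u| / 8)) := by
  have hsum : ∑ k ∈ range N, (ε : ℂ) ^ k *
        ((u : ℂ) ^ k * (iteratedDeriv k (gaussPsi u) 0 / k.factorial))
      = ∑ k ∈ range N, iteratedDeriv k (gaussPsi u) 0 / k.factorial * ((ε * u : ℝ) : ℂ) ^ k := by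
    refine sum_congr rfl fun k _ => ?_
    push_cast
    ring
  have hnorm : ‖((ε * u : ℝ) : ℂ)‖ = ε * |u| := by
    rw [Complex.norm_real, Real.norm_eq_abs, abs_mul, abs_of_pos hε]
  have hE := Real.exp_pos (-|u| / 8)
  rw [hsum]
  rcases le_total (ε * |u|) (1 / 2) with h | h
  · refine (norm_sub_taylor_le (differentiable_gaussPsi u)
      (fun z hz => (norm_gaussPsi_le u hz).trans (exp_neg_sq_div_four_le u)) N
      (hnorm.trans_le h)).trans ?_
    rw [hnorm, mul_pow]
    have : 0 ≤ ε ^ N * (2 ^ N * (1 + 3 * N)) * (|u| ^ N * Real.exp (-|u| / 8)) := by positivity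
    linarith
  · have h1 : ‖gaussPsi u ((ε * u : ℝ) : ℂ)‖ ≤ (2 * (ε * |u|)) ^ N * Real.exp (-|u| / 8) := by
      refine (norm_gaussPsi_mul_le hε hε1 (by rwa [abs_mul, abs_of_pos hε])).trans ?_
      exact le_mul_of_one_le_left hE.le (one_le_pow₀ (by linarith))
    have h2 : ‖∑ k ∈ range N, iteratedDeriv k (gaussPsi u) 0 / k.factorial *
        ((ε * u : ℝ) : ℂ) ^ k‖ ≤ N * (3 * Real.exp (-|u| / 8) * (2 * (ε * |u|)) ^ N) := by
      refine (norm_sum_le_of_le _ (f := _) (n := fun _ => 3 * Real.exp (-|u| / 8)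
        * (2 * (ε * |u|)) ^ N) fun k hk => ?_).trans_eq (by simp)
      rw [norm_mul, norm_pow, hnorm]
      refine mul_le_mul (norm_iteratedDeriv_gaussPsi_le k u) ?_ (by positivity) (by positivity)
      calc (ε * |u|) ^ k ≤ (2 * (ε * |u|)) ^ k := pow_le_pow_left₀ (by positivity) (by linarith) k
        _ ≤ (2 * (ε * |u|)) ^ N := pow_le_pow_right₀ (by linarith) (mem_range.1 hk).le
    refine (norm_sub_le _ _).trans ((add_le_add h1 h2).trans ?_)
    have : 0 ≤ ε ^ N * 6 * (|u| ^ N * Real.exp (-|u| / 8)) := by positivity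
    rw [mul_pow, mul_pow]
    linarith

theorem exists_norm_integral_gaussPsi_mul_sub_le (N : ℕ) : ∃ C : ℝ, ∀ ε : ℝ, 0 < ε → ε ≤ 1 →
    ‖(∫ u : ℝ, gaussPsi u ((ε * u : ℝ) : ℂ)) - ∑ k ∈ range N, (ε : ℂ) ^ k *
        ∫ u : ℝ, (u : ℂ) ^ k * (iteratedDeriv k (gaussPsi u) 0 / k.factorial)‖ ≤ C * ε ^ N := by
  refine ⟨(6 + 2 ^ N * (1 + 3 * N)) * ∫ u : ℝ, |u| ^ N * Real.exp (-|u| / 8), fun ε hε hε1 => ?_⟩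
  have hterm (k : ℕ) := (integrable_pow_mul_iteratedDeriv_gaussPsi k).const_mul ((ε : ℂ) ^ k)
  have hsum := MeasureTheory.integrable_finsetSum (range N) fun k _ => hterm k
  have hmaj := (integrable_abs_pow_mul_exp_neg_abs N).const_mul
    (ε ^ N * (6 + 2 ^ N * (1 + 3 * N)))
  have hcont : Continuous fun u : ℝ => gaussPsi u ((ε * u : ℝ) : ℂ) :=
    continuous_gaussPsi.comp
      (by fun_prop : Continuous fun u : ℝ => (u, ((ε * u : ℝ) : ℂ)))
  have hbound := norm_gaussPsi_mul_sub_taylor_le hε hε1 N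
  have hdiff := hmaj.mono' (hcont.aestronglyMeasurable.sub hsum.aestronglyMeasurable)
    (Eventually.of_forall hbound)
  have hG : MeasureTheory.Integrable fun u : ℝ => gaussPsi u ((ε * u : ℝ) : ℂ) := by
    refine (hdiff.add hsum).congr (Eventually.of_forall fun u => ?_)
    simp
  have h := MeasureTheory.norm_integral_le_of_norm_le hmaj (Eventually.of_forall hbound)
  rw [MeasureTheory.integral_sub hG hsum, MeasureTheory.integral_finsetSum _ fun k _ => hterm k,
    MeasureTheory.integral_const_mul] at h
  simp only [MeasureTheory.integral_const_mul] at h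
  linarith

theorem Gamma_eq_integral_exp {x ε : ℝ} (hx : 0 < x) (hε : 0 < ε) (hxε : x * ε ^ 2 = 1) :
    Real.Gamma x = ε * x ^ x * Real.exp (-x) *
      ∫ u : ℝ, Real.exp (-(Real.exp (ε * u) - ε * u - 1) / ε ^ 2) := by
  have himg : (fun u : ℝ => x * Real.exp (ε * u)) '' Set.univ = Set.Ioi 0 := by
    ext y
    simp only [Set.image_univ, Set.mem_range, Set.mem_Ioi]
    constructor
    · rintro ⟨u, rfl⟩
      positivity
    · intro hy
      refine ⟨Real.log (y / x) / ε, ?_⟩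
      rw [mul_div_cancel₀ _ hε.ne', Real.exp_log (by positivity), mul_div_cancel₀ _ hx.ne']
  have hderiv (u : ℝ) : HasDerivAt (fun u : ℝ => x * Real.exp (ε * u))
      (x * (Real.exp (ε * u) * ε)) u := by
    simpa using (((hasDerivAt_id u).const_mul ε).exp).const_mul x
  have hinj : Set.InjOn (fun u : ℝ => x * Real.exp (ε * u)) Set.univ := by
    intro u _ v _ huv
    simpa [hx.ne', hε.ne'] using huv
  have h := MeasureTheory.integral_image_eq_integral_abs_deriv_smul MeasurableSet.univ
    (fun u _ => (hderiv u).hasDerivWithinAt) hinj (fun t => Real.exp (-t) * t ^ (x - 1))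
  rw [himg, MeasureTheory.Measure.restrict_univ, ← Real.Gamma_eq_integral hx] at h
  rw [h, ← MeasureTheory.integral_const_mul]
  congr 1 with u
  have hx2 : (ε ^ 2)⁻¹ = x := (eq_inv_of_mul_eq_one_left hxε).symm
  rw [abs_of_pos (by positivity), smul_eq_mul, div_eq_mul_inv, hx2, Real.mul_rpow hx.le
    (Real.exp_pos _).le, ← Real.exp_mul, Real.rpow_sub_one hx.ne']
  have e1 : Real.exp (-(Real.exp (ε * u) - ε * u - 1) * x)
      = Real.exp x * Real.exp (-(x * Real.exp (ε * u))) * Real.exp (ε * u * (x - 1))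
        * Real.exp (ε * u) := by
    rw [← Real.exp_add, ← Real.exp_add, ← Real.exp_add]
    ring_nf
  rw [e1, Real.exp_neg x]
  have := Real.exp_ne_zero x
  field_simp

theorem sqrt_two_pi_mul_GammaStar {x ε : ℝ} (hx : 0 < x) (hε : 0 < ε) (hxε : x * ε ^ 2 = 1) :
    ((Real.sqrt (2 * Real.pi) * GammaStar x : ℝ) : ℂ)
      = ∫ u : ℝ, gaussPsi u ((ε * u : ℝ) : ℂ) := by
  simp only [gaussPsi_mul hε.ne', integral_complex_ofReal]
  congr 1
  have hpi := Real.pi_pos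
  have hs : Real.sqrt x * ε = 1 := by
    have h1 : (Real.sqrt x * ε) ^ 2 = 1 := by rw [mul_pow, Real.sq_sqrt hx.le, hxε]
    exact (pow_eq_one_iff_of_nonneg (by positivity) two_ne_zero).1 h1
  have hs0 := Real.sqrt_pos.2 hx
  have hxx : x ^ x ≠ 0 := (Real.rpow_pos_of_pos hx x).ne'
  rw [GammaStar, Gamma_eq_integral_exp hx hε hxε, Real.rpow_sub hx, ← Real.sqrt_eq_rpow]
  have h2 : Real.sqrt (2 * Real.pi) ≠ 0 := by positivity
  have h3 := Real.exp_ne_zero (-x)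
  field_simp
  linear_combination
    (∫ u : ℝ, Real.exp (-((Real.exp (ε * u) - ε * u - 1) / ε ^ 2))) * hs

theorem sum_range_two_mul_of_odd_eq_zero {f : ℕ → ℂ} (hf : ∀ n, f (2 * n + 1) = 0) (m : ℕ) :
    ∑ k ∈ range (2 * m), f k = ∑ n ∈ range m, f (2 * n) := by
  induction m with
  | zero => simp
  | succ m ih => rw [Nat.mul_succ, sum_range_succ, sum_range_succ, hf, add_zero, ih, sum_range_succ]

/-- For every `m ≥ 1`, as `x → ∞`,
`Γ*(x) − Σ_{n=0}^{m−1} (−1)ⁿ γₙ x^{−n} = O(x^{−m})`. -/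
theorem gammaStar_asymptotic_expansion (m : ℕ) (hm : 1 ≤ m) :
    (fun x : ℝ => GammaStar x - ∑ n ∈ Finset.range m, (-1) ^ n * stirlingGamma n * x ^ (-(n : ℝ)))
      =O[atTop] fun x : ℝ => x ^ (-(m : ℝ)) := by
  obtain ⟨C, hC⟩ := exists_norm_integral_gaussPsi_mul_sub_le (2 * m)
  have hS : 0 < Real.sqrt (2 * Real.pi) := Real.sqrt_pos.2 (by linarith [Real.pi_pos])
  refine IsBigO.of_bound (C / Real.sqrt (2 * Real.pi)) ?_
  filter_upwards [eventually_ge_atTop 1] with x hx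
  have hx0 : 0 < x := by linarith
  set ε := (Real.sqrt x)⁻¹ with hεdef
  have hε : 0 < ε := by positivity
  have hε1 : ε ≤ 1 := inv_le_one_of_one_le₀ (Real.one_le_sqrt.2 hx)
  have hε2 : ε ^ 2 = x⁻¹ := by rw [hεdef, inv_pow, Real.sq_sqrt hx0.le]
  have hpow (n : ℕ) : x ^ (-(n : ℝ)) = ε ^ (2 * n) := by
    rw [Real.rpow_neg hx0.le, Real.rpow_natCast, pow_mul, hε2, inv_pow]
  have h := hC ε hε hε1
  rw [← sqrt_two_pi_mul_GammaStar hx0 hε (by rw [hε2, mul_inv_cancel₀ hx0.ne']),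
    sum_range_two_mul_of_odd_eq_zero
      (fun n => by rw [integral_odd_pow_mul_iteratedDeriv_gaussPsi, mul_zero])] at h
  simp only [integral_even_pow_mul_iteratedDeriv_gaussPsi] at h
  simp only [← Complex.ofReal_mul,
    ← Complex.ofReal_pow, ← Complex.ofReal_sum, ← Complex.ofReal_sub, Complex.norm_real] at h
  have e : Real.sqrt (2 * Real.pi) * GammaStar x - ∑ n ∈ range m,
        ε ^ (2 * n) * (Real.sqrt (2 * Real.pi) * ((-1) ^ n * stirlingGamma n))
      = Real.sqrt (2 * Real.pi) * (GammaStar x - ∑ n ∈ range m,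
        (-1) ^ n * stirlingGamma n * x ^ (-(n : ℝ))) := by
    rw [mul_sub, mul_sum]
    congr 1
    refine sum_congr rfl fun n _ => ?_
    rw [hpow]
    ring
  rw [e, norm_mul, Real.norm_of_nonneg hS.le] at h
  rw [hpow m, Real.norm_of_nonneg (by positivity : 0 ≤ ε ^ (2 * m)), div_mul_eq_mul_div,
    le_div_iff₀ hS]
  linarith
end

section
/- Let T : ℝ → ℝ be the inverse of the bijection U(t) = sign(t)·√(2(e^t − t − 1)). Then T is differentiable on ℝ and, for every real x > 0, Γ*(x) = (x/(2π))^{1/2} ∫_{−∞}^{∞} e^{−x u²/2} T′(u) du. -/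
open MeasureTheory

/-- The change-of-variable function `U(t) = sign(t)·√(2(eᵗ − t − 1))`. -/
noncomputable def U (t : ℝ) : ℝ :=
  if 0 ≤ t then Real.sqrt (2 * (Real.exp t - t - 1))
  else -Real.sqrt (2 * (Real.exp t - t - 1))

open Filter Topology

theorem two_mul_exp_sub_id_sub_one_pos {t : ℝ} (ht : t ≠ 0) :
    0 < 2 * (Real.exp t - t - 1) := by
  have := Real.add_one_lt_exp ht
  linarith

theorem U_sq (t : ℝ) : U t ^ 2 = 2 * (Real.exp t - t - 1) := by
  have h : 0 ≤ 2 * (Real.exp t - t - 1) := by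
    have := Real.add_one_le_exp t
    linarith
  unfold U
  split_ifs
  · exact Real.sq_sqrt h
  · rw [neg_sq, Real.sq_sqrt h]

theorem U_zero : U 0 = 0 := by
  simp [U]

theorem abs_two_mul_exp_sub_id_sub_one_div_sq_sub_one_le {t : ℝ} (ht : t ≠ 0) (h1 : |t| ≤ 1) :
    |2 * (Real.exp t - t - 1) / t ^ 2 - 1| ≤ 4 / 9 * |t| := by
  have h := Real.exp_bound h1 (n := 3) (by norm_num)
  norm_num [Finset.sum_range_succ, Nat.factorial] at h
  have e : 2 * (Real.exp t - t - 1) / t ^ 2 - 1 =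
      2 * (Real.exp t - (1 + t + t ^ 2 / 2)) / t ^ 2 := by
    field_simp
    ring
  rw [e, abs_div, abs_mul, abs_pow, abs_two, div_le_iff₀ (by positivity)]
  linarith

theorem tendsto_two_mul_exp_sub_id_sub_one_div_sq :
    Tendsto (fun t : ℝ => 2 * (Real.exp t - t - 1) / t ^ 2) (𝓝[≠] 0) (𝓝 1) := by
  rw [tendsto_iff_norm_sub_tendsto_zero]
  have hlim : Tendsto (fun t : ℝ => 4 / 9 * |t|) (𝓝[≠] 0) (𝓝 0) := by
    have : Continuous fun t : ℝ => 4 / 9 * |t| := by fun_prop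
    simpa using (this.tendsto 0).mono_left nhdsWithin_le_nhds
  refine squeeze_zero' (Eventually.of_forall fun _ => norm_nonneg _) ?_ hlim
  have hball : ∀ᶠ t : ℝ in 𝓝[≠] 0, |t| < 1 :=
    nhdsWithin_le_nhds ((continuous_abs.tendsto (0 : ℝ)).eventually_lt_const (by simp))
  filter_upwards [self_mem_nhdsWithin, hball] with t ht h1
  exact abs_two_mul_exp_sub_id_sub_one_div_sq_sub_one_le ht h1.le

theorem U_div_self {t : ℝ} (ht : t ≠ 0) :
    U t / t = Real.sqrt (2 * (Real.exp t - t - 1) / t ^ 2) := by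
  rw [Real.sqrt_div (two_mul_exp_sub_id_sub_one_pos ht).le, Real.sqrt_sq_eq_abs]
  unfold U
  split_ifs with h
  · rw [abs_of_nonneg h]
  · rw [abs_of_neg (not_le.mp h), div_neg, neg_div]

theorem hasDerivAt_U_zero : HasDerivAt U 1 0 := by
  rw [hasDerivAt_iff_tendsto_slope]
  have h := (Real.continuous_sqrt.tendsto 1).comp tendsto_two_mul_exp_sub_id_sub_one_div_sq
  rw [Real.sqrt_one] at h
  refine h.congr' ?_
  filter_upwards [self_mem_nhdsWithin] with t ht
  simp [slope_def_field, U_zero, U_div_self ht]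

theorem hasDerivAt_U_of_ne {t : ℝ} (ht : t ≠ 0) :
    HasDerivAt U ((Real.exp t - 1) / U t) t := by
  have hpos := two_mul_exp_sub_id_sub_one_pos ht
  have hs : HasDerivAt (fun s : ℝ => Real.sqrt (2 * (Real.exp s - s - 1)))
      ((2 * (Real.exp t - 1)) / (2 * Real.sqrt (2 * (Real.exp t - t - 1)))) t :=
    ((((Real.hasDerivAt_exp t).sub (hasDerivAt_id t)).sub_const 1).const_mul 2).sqrt hpos.ne'
  rw [mul_div_mul_left _ _ two_ne_zero] at hs
  rcases ht.lt_or_gt with h | h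
  · have hU : U =ᶠ[𝓝 t] fun s => -Real.sqrt (2 * (Real.exp s - s - 1)) := by
      filter_upwards [Iio_mem_nhds h] with s hs
      exact if_neg (not_le.mpr hs)
    rw [hU.eq_of_nhds, div_neg]
    exact hs.neg.congr_of_eventuallyEq hU
  · have hU : U =ᶠ[𝓝 t] fun s => Real.sqrt (2 * (Real.exp s - s - 1)) := by
      filter_upwards [Ioi_mem_nhds h] with s hs
      exact if_pos (le_of_lt hs)
    rw [hU.eq_of_nhds]
    exact hs.congr_of_eventuallyEq hU

theorem exists_hasDerivAt_U_pos (t : ℝ) : ∃ d, 0 < d ∧ HasDerivAt U d t := by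
  rcases lt_trichotomy t 0 with h | rfl | h
  · refine ⟨_, div_pos_of_neg_of_neg ?_ ?_, hasDerivAt_U_of_ne h.ne⟩
    · simpa using h
    · rw [U, if_neg (not_le.mpr h), neg_lt_zero]
      exact Real.sqrt_pos.mpr (two_mul_exp_sub_id_sub_one_pos h.ne)
  · exact ⟨1, one_pos, hasDerivAt_U_zero⟩
  · refine ⟨_, div_pos ?_ ?_, hasDerivAt_U_of_ne h.ne'⟩
    · simpa using h
    · rw [U, if_pos h.le]
      exact Real.sqrt_pos.mpr (two_mul_exp_sub_id_sub_one_pos h.ne')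

theorem strictMono_U : StrictMono U := by
  choose d hd hU using exists_hasDerivAt_U_pos
  exact strictMono_of_hasDerivAt_pos hU hd

theorem exists_hasDerivAt_inverse_U_pos {T : ℝ → ℝ} (hT₁ : Function.LeftInverse T U)
    (hT₂ : Function.RightInverse T U) (u : ℝ) : ∃ d, 0 < d ∧ HasDerivAt T d u := by
  have hmono : Monotone T := fun a b hab => by
    rwa [← strictMono_U.le_iff_le, hT₂ a, hT₂ b]
  have hcont : Continuous T := hmono.continuous_of_surjective hT₁.surjective
  obtain ⟨d, hd, hU⟩ := exists_hasDerivAt_U_pos (T u)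
  exact ⟨d⁻¹, inv_pos.mpr hd,
    hU.of_local_left_inverse hcont.continuousAt hd.ne' (Eventually.of_forall hT₂)⟩

theorem integral_exp_neg_mul_exp_sub_id_sub_one {x : ℝ} (hx : 0 < x) :
    ∫ t : ℝ, Real.exp (-x * (Real.exp t - t - 1)) =
      Real.exp x * ((1 / x) ^ x * Real.Gamma x) := by
  have h := integral_image_eq_integral_abs_deriv_smul MeasurableSet.univ
    (fun t _ => (Real.hasDerivAt_exp t).hasDerivWithinAt) Real.exp_injective.injOn
    (fun s : ℝ => s ^ (x - 1) * Real.exp (-(x * s)))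
  rw [Set.image_univ, Real.range_exp, Real.integral_rpow_mul_exp_neg_mul_Ioi hx hx,
    setIntegral_univ] at h
  rw [h, ← integral_const_mul]
  congr 1 with t
  rw [smul_eq_mul, Real.abs_exp, ← Real.exp_mul, ← Real.exp_add, ← Real.exp_add, ← Real.exp_add]
  congr 1
  ring

theorem integral_exp_neg_mul_sq_mul_deriv_inverse_U {T : ℝ → ℝ}
    (hT₁ : Function.LeftInverse T U) (hT₂ : Function.RightInverse T U) (x : ℝ) :
    ∫ u : ℝ, Real.exp (-x * u ^ 2 / 2) * deriv T u =
      ∫ t : ℝ, Real.exp (-x * (Real.exp t - t - 1)) := by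
  choose d hd hT using exists_hasDerivAt_inverse_U_pos hT₁ hT₂
  have h := integral_image_eq_integral_abs_deriv_smul MeasurableSet.univ
    (fun u _ => (hT u).hasDerivWithinAt) hT₂.injective.injOn
    (fun t : ℝ => Real.exp (-x * (Real.exp t - t - 1)))
  rw [Set.image_univ, hT₁.surjective.range_eq, setIntegral_univ, setIntegral_univ] at h
  rw [h]
  congr 1 with u
  have hu := U_sq (T u)
  rw [hT₂ u] at hu
  rw [smul_eq_mul, abs_of_pos (hd u), (hT u).deriv, mul_comm, hu]
  congr 2
  ring

/-- If `T` is the inverse of the bijection `U`, then `T` is differentiable on `ℝ` and, for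
every `x > 0`, `Γ*(x) = (x/(2π))^{1/2} ∫_{−∞}^∞ e^{−xu²/2} T′(u) du`. -/
theorem gammaStar_eq_integral_inverse (T : ℝ → ℝ)
    (hT₁ : Function.LeftInverse T U) (hT₂ : Function.RightInverse T U) :
    Differentiable ℝ T ∧
    ∀ x : ℝ, 0 < x →
      GammaStar x =
        (x / (2 * Real.pi)) ^ ((1 : ℝ) / 2) *
          ∫ u : ℝ, Real.exp (-x * u ^ 2 / 2) * deriv T u := by
  refine ⟨fun u => ?_, fun x hx => ?_⟩
  · obtain ⟨d, -, hd⟩ := exists_hasDerivAt_inverse_U_pos hT₁ hT₂ u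
    exact hd.differentiableAt
  · have hpi := Real.pi_pos
    rw [integral_exp_neg_mul_sq_mul_deriv_inverse_U hT₁ hT₂,
      integral_exp_neg_mul_exp_sub_id_sub_one hx, GammaStar, Real.div_rpow hx.le (by positivity),
      ← Real.sqrt_eq_rpow (2 * Real.pi), one_div x, Real.inv_rpow hx.le, Real.rpow_sub hx,
      Real.exp_neg]
    have h1 : x ^ x ≠ 0 := (Real.rpow_pos_of_pos hx _).ne'
    have h2 : x ^ ((1 : ℝ) / 2) ≠ 0 := (Real.rpow_pos_of_pos hx _).ne'
    have h3 : Real.sqrt (2 * Real.pi) ≠ 0 := (Real.sqrt_pos.mpr (by positivity)).ne'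
    have h4 := (Real.exp_pos x).ne'
    field_simp
end

section
/- For every integer n ≥ 1, D^{2n}[φ^{2n+1}](0) = D^{2n}[Λ^{−n−1/2}](0); that is, the Stirling coefficients satisfy γ_n = ((−1)^n/(2^n n!)) · D^{2n}[Λ^{−n−1/2}](0), so the representation of Brassesco and Méndez is equivalent to the representation γ_n = ((−1)^n/(2^n n!)) · D^{2n}[φ^{2n+1}](0). -/
/-- `λ(z) = (log(1+z) − z + z²/2)/z²` for `z ≠ 0`, with `λ(0) = 0`. -/
noncomputable def lam (z : ℝ) : ℝ :=
  if z = 0 then 0 else (Real.log (1 + z) - z + z ^ 2 / 2) / z ^ 2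

/-- `Λ(z) = 1 − 2λ(z)`. -/
noncomputable def Lam (z : ℝ) : ℝ := 1 - 2 * lam z

open Filter Topology

lemma AnalyticAt.dslope_self {f : ℝ → ℝ} {a : ℝ} (hf : AnalyticAt ℝ f a) :
    AnalyticAt ℝ (dslope f a) a := by
  obtain ⟨p, hp⟩ := hf
  exact ⟨_, hp.has_fpower_series_dslope_fslope⟩

lemma AnalyticAt.real_rpow_const {f : ℝ → ℝ} {a : ℝ} (hf : AnalyticAt ℝ f a) (ha : 0 < f a)
    (c : ℝ) : AnalyticAt ℝ (fun t => f t ^ c) a := by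
  have h : AnalyticAt ℝ (fun t => Real.exp (Real.log (f t) * c)) a :=
    ((hf.log ha).mul analyticAt_const).rexp
  refine h.congr ?_
  filter_upwards [hf.continuousAt.eventually (lt_mem_nhds ha)] with t ht
  rw [Real.rpow_def_of_pos ht]

lemma analyticAt_id_mul {h : ℝ → ℝ} {a : ℝ} (hh : AnalyticAt ℝ h a) :
    AnalyticAt ℝ (fun t => t * h t) a :=
  analyticAt_id.mul hh

/-- The derivatives of `t ↦ t * h t` at the origin. -/
lemma iteratedDeriv_id_mul_zero {h : ℝ → ℝ} (hh : AnalyticAt ℝ h 0) (k : ℕ) :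
    iteratedDeriv k (fun t => t * h t) 0 = k * iteratedDeriv (k - 1) h 0 := by
  induction k generalizing h with
  | zero => simp
  | succ k ih =>
    have hd : deriv (fun t => t * h t) =ᶠ[𝓝 0] fun t => h t + t * deriv h t := by
      filter_upwards [hh.eventually_analyticAt] with t ht
      rw [deriv_fun_mul differentiableAt_fun_id ht.differentiableAt]
      simp
    rw [iteratedDeriv_succ', hd.iteratedDeriv_eq,
      iteratedDeriv_fun_add hh.contDiffAt (analyticAt_id_mul hh.deriv).contDiffAt, ih hh.deriv]
    cases k with
    | zero => simp
    | succ k =>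
      simp only [Nat.add_sub_cancel, ← iteratedDeriv_succ']
      push_cast
      ring

/-- The coefficient of `t ^ k` in `k * P - t * P'` vanishes. -/
lemma iteratedDeriv_euler_zero {P : ℝ → ℝ} (hP : AnalyticAt ℝ P 0) (k : ℕ) :
    iteratedDeriv k (fun t => k * P t - t * deriv P t) 0 = 0 := by
  rw [iteratedDeriv_fun_sub (analyticAt_const.fun_mul hP).contDiffAt
    (analyticAt_id_mul hP.deriv).contDiffAt, iteratedDeriv_id_mul_zero hP.deriv,
    iteratedDeriv_const_mul_field]
  cases k with
  | zero => simp
  | succ k => simp [← iteratedDeriv_succ']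

/-- Invariance of the residue of `g z / z ^ (m + 1)` under the change of variable `z = u t`,
where `q t = t / u t`. -/
lemma iteratedDeriv_residue_comp {u q : ℝ → ℝ} (hu : AnalyticAt ℝ u 0) (hq : AnalyticAt ℝ q 0)
    (hu0 : u 0 = 0) (huq : ∀ᶠ t in 𝓝 0, u t * q t = t) (m : ℕ) {g : ℝ → ℝ}
    (hg : AnalyticAt ℝ g 0) :
    iteratedDeriv m (fun t => g (u t) * q t ^ (m + 1) * deriv u t) 0 = iteratedDeriv m g 0 := by
  have hderiv : ∀ᶠ t in 𝓝 0, deriv u t * q t + u t * deriv q t = 1 := by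
    filter_upwards [huq.eventually_nhds, hu.eventually_analyticAt, hq.eventually_analyticAt]
      with t h hut hqt
    rw [← deriv_fun_mul hut.differentiableAt hqt.differentiableAt, EventuallyEq.deriv_eq h]
    simp
  induction m generalizing g with
  | zero =>
    have h := hderiv.self_of_nhds
    rw [hu0] at h
    simp only [iteratedDeriv_zero, hu0]
    linear_combination g 0 * h
  | succ m ih =>
    have hh := hg.dslope_self
    set h := dslope g 0
    have hgh : ∀ z, g z = g 0 + z * h z := fun z => by
      have := sub_smul_dslope g 0 z
      simp only [sub_zero, smul_eq_mul] at this
      linarith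
    have hhu : AnalyticAt ℝ (fun t => h (u t)) 0 :=
      AnalyticAt.fun_comp (by rwa [hu0]) hu
    have hP : AnalyticAt ℝ (fun t => q t ^ (m + 1)) 0 := hq.pow _
    have hL : AnalyticAt ℝ (fun t => h (u t) * q t ^ (m + 1) * deriv u t) 0 :=
      (hhu.mul hP).mul hu.deriv
    have hE : AnalyticAt ℝ (fun t => ((m + 1 : ℕ) : ℝ) * q t ^ (m + 1)
        - t * deriv (fun t => q t ^ (m + 1)) t) 0 :=
      (analyticAt_const.mul hP).sub (analyticAt_id.mul hP.deriv)
    have key : (fun t => g (u t) * q t ^ (m + 1 + 1) * deriv u t) =ᶠ[𝓝 0]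
        fun t => g 0 / (m + 1) * (((m + 1 : ℕ) : ℝ) * q t ^ (m + 1)
          - t * deriv (fun t => q t ^ (m + 1)) t) +
          t * (h (u t) * q t ^ (m + 1) * deriv u t) := by
      filter_upwards [huq, hderiv, hq.eventually_analyticAt] with t h1 h2 hqt
      rw [deriv_fun_pow hqt.differentiableAt, hgh (u t)]
      have hm : (m : ℝ) + 1 ≠ 0 := by positivity
      push_cast
      field_simp
      linear_combination (g 0 * q t ^ (m + 1)) * h2
        + (h (u t) * q t ^ (m + 1) * deriv u t - g 0 * q t ^ m * deriv q t) * h1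
    have hgf : iteratedDeriv (m + 1) g 0 = (m + 1) * iteratedDeriv m h 0 := by
      have : g = fun z => g 0 + z * h z := funext hgh
      rw [this, iteratedDeriv_const_add (Nat.succ_pos m), iteratedDeriv_id_mul_zero hh]
      simp
    rw [key.iteratedDeriv_eq, iteratedDeriv_fun_add (analyticAt_const.fun_mul hE).contDiffAt
      (analyticAt_id_mul hL).contDiffAt, iteratedDeriv_const_mul_field,
      iteratedDeriv_euler_zero hP, iteratedDeriv_id_mul_zero hL, hgf, Nat.add_sub_cancel, ih hh]
    simp

lemma analyticAt_Lam : AnalyticAt ℝ Lam 0 := by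
  have hlog : AnalyticAt ℝ (fun z : ℝ => Real.log (1 + z)) 0 :=
    (analyticAt_const.add analyticAt_id).log (by simp)
  obtain ⟨F, hF, h⟩ := hlog.exists_eventuallyEq_sum_add_pow_mul 3
  have hd : deriv (fun z : ℝ => Real.log (1 + z)) = fun z => (1 + z)⁻¹ := by
    ext z
    rw [deriv_comp_const_add Real.log 1 z, Real.deriv_log]
  have hd2 : deriv (fun z : ℝ => (1 + z)⁻¹) 0 = -1 := by
    rw [deriv_comp_const_add (fun z : ℝ => z⁻¹) 1 0]
    simp
  have : AnalyticAt ℝ (fun z => 1 - 2 * (z * F z)) 0 :=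
    analyticAt_const.sub (analyticAt_const.mul (analyticAt_id.mul hF))
  refine this.congr ?_
  filter_upwards [h] with z hz
  rw [Finset.sum_range_succ, Finset.sum_range_succ, Finset.sum_range_one, iteratedDeriv_succ',
    iteratedDeriv_succ', hd, iteratedDeriv_one, hd2] at hz
  simp only [iteratedDeriv_zero, smul_eq_mul] at hz
  norm_num at hz
  unfold Lam lam
  split_ifs with h0
  · simp [h0]
  · rw [hz]
    field_simp
    ring

lemma Lam_zero : Lam 0 = 1 := by simp [Lam, lam]

lemma two_mul_exp_sub_mul_phi_sq (t : ℝ) : 2 * (Real.exp t - t - 1) * phi t ^ 2 = t ^ 2 := by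
  unfold phi
  split_ifs with h
  · simp [h]
  · have := Real.add_one_lt_exp h
    have h2 : 0 < 2 * (Real.exp t - t - 1) := by linarith
    rw [Real.sq_sqrt (by positivity), mul_div_cancel₀ _ h2.ne']

lemma phi_nonneg (t : ℝ) : 0 ≤ phi t := by
  unfold phi
  split_ifs <;> positivity

lemma Lam_exp_sub_one_mul_phi_sq {t q : ℝ} (hq : (Real.exp t - 1) * q = t) (ht : t = 0 → q = 1) :
    Lam (Real.exp t - 1) * phi t ^ 2 = q ^ 2 := by
  by_cases h : t = 0
  · simp [h, Lam_zero, phi, ht h]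
  · have hu : Real.exp t - 1 ≠ 0 := by
      intro h0
      rw [h0, zero_mul] at hq
      exact h hq.symm
    have h1 : Lam (Real.exp t - 1) * (Real.exp t - 1) ^ 2 = 2 * (Real.exp t - t - 1) := by
      unfold Lam lam
      rw [if_neg hu, add_sub_cancel, Real.log_exp]
      field_simp
      ring
    apply mul_right_cancel₀ (pow_ne_zero 2 hu)
    linear_combination phi t ^ 2 * h1 + two_mul_exp_sub_mul_phi_sq t
      - (t + (Real.exp t - 1) * q) * hq

lemma eq_mul_rpow_neg_half {L p q : ℝ} (hL : 0 < L) (hp : 0 ≤ p) (hq : 0 ≤ q)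
    (h : L * p ^ 2 = q ^ 2) : p = q * L ^ (-(1 / 2) : ℝ) := by
  rw [Real.rpow_neg hL.le, ← Real.sqrt_eq_rpow, ← Real.sqrt_sq hq, ← h,
    Real.sqrt_mul hL.le, Real.sqrt_sq hp]
  have := (Real.sqrt_pos.2 hL).ne'
  field_simp

lemma iteratedDeriv_phi_pow_eq (n : ℕ) (hn : 1 ≤ n) :
    iteratedDeriv (2 * n) (fun t => phi t ^ (2 * n + 1)) 0 =
      iteratedDeriv (2 * n) (fun z => Lam z ^ (-(n : ℝ) - 1 / 2)) 0 := by
  set u : ℝ → ℝ := fun t => Real.exp t - 1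
  have hu : AnalyticAt ℝ u 0 := analyticAt_rexp.sub analyticAt_const
  have hu0 : u 0 = 0 := by simp [u]
  have hdu : deriv u = Real.exp := by
    ext t
    simp [u]
  set s := dslope u 0
  have hs : AnalyticAt ℝ s 0 := hu.dslope_self
  have hs0 : s 0 = 1 := by simp [s, dslope_same, hdu]
  have hus : ∀ t, t * s t = u t := fun t => by
    simpa [hu0] using sub_smul_dslope u 0 t
  set q : ℝ → ℝ := fun t => (s t)⁻¹
  have hq : AnalyticAt ℝ q 0 := hs.inv (by simp [hs0])
  have hq0 : q 0 = 1 := by simp [q, hs0]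
  have huq : ∀ᶠ t in 𝓝 0, u t * q t = t := by
    filter_upwards [hs.continuousAt.eventually_ne (hs0.trans_ne one_ne_zero)] with t ht
    rw [← hus]
    simp only [q]
    field_simp
  have hLu : AnalyticAt ℝ (fun t => Lam (u t)) 0 :=
    AnalyticAt.fun_comp (by rw [hu0]; exact analyticAt_Lam) hu
  have hphi : ∀ᶠ t in 𝓝 0,
      0 < Lam (u t) ∧ phi t = q t * Lam (u t) ^ (-(1 / 2) : ℝ) := by
    filter_upwards [huq,
      hLu.continuousAt.eventually (lt_mem_nhds (a := 0) (by simp [hu0, Lam_zero])),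
      hq.continuousAt.eventually (lt_mem_nhds (a := 0) (by simp [hq0]))] with t h1 h2 h3
    exact ⟨h2, eq_mul_rpow_neg_half h2 (phi_nonneg t) h3.le
      (Lam_exp_sub_one_mul_phi_sq h1 (fun h => h ▸ hq0))⟩
  have hphiA : AnalyticAt ℝ phi 0 := by
    refine (hq.mul (hLu.real_rpow_const (by simp [hu0, Lam_zero]) (-(1 / 2)))).congr ?_
    filter_upwards [hphi] with t ht
    exact ht.2.symm
  have hg := analyticAt_Lam.real_rpow_const (by simp [Lam_zero]) (-(n : ℝ) - 1 / 2)
  rw [← iteratedDeriv_residue_comp hu hq hu0 huq (2 * n) hg]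
  obtain ⟨k, rfl⟩ : ∃ k, n = k + 1 := ⟨n - 1, by omega⟩
  have hP : AnalyticAt ℝ (fun t => phi t ^ (2 * k + 1)) 0 := hphiA.pow _
  have hE : AnalyticAt ℝ (fun t => ((2 * k + 1 : ℕ) : ℝ) * phi t ^ (2 * k + 1)
      - t * deriv (fun t => phi t ^ (2 * k + 1)) t) 0 :=
    (analyticAt_const.mul hP).sub (analyticAt_id.mul hP.deriv)
  have key : (fun t => Lam (u t) ^ (-((k + 1 : ℕ) : ℝ) - 1 / 2) * q t ^ (2 * (k + 1) + 1)
      * deriv u t) =ᶠ[𝓝 0] fun t => phi t ^ (2 * (k + 1) + 1) +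
        (2 * k + 1 : ℝ)⁻¹ * (t * (((2 * k + 1 : ℕ) : ℝ) * phi t ^ (2 * k + 1)
          - t * deriv (fun t => phi t ^ (2 * k + 1)) t)) := by
    filter_upwards [hphi, hphiA.eventually_analyticAt] with t ⟨hpos, ht⟩ hpt
    have h1 : Lam (u t) ^ (-((k + 1 : ℕ) : ℝ) - 1 / 2) * q t ^ (2 * (k + 1) + 1)
        = phi t ^ (2 * (k + 1) + 1) := by
      rw [ht, mul_pow, ← Real.rpow_mul_natCast hpos.le, mul_comm]
      congr 2
      push_cast
      ring
    have h2 : HasDerivAt (fun t => 2 * (Real.exp t - t - 1) * phi t ^ 2)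
        (2 * (Real.exp t - 1) * phi t ^ 2
          + 2 * (Real.exp t - t - 1) * (2 * phi t * deriv phi t)) t := by
      have h3 := ((((Real.hasDerivAt_exp t).sub (hasDerivAt_id t)).sub_const 1).const_mul 2).mul
        (hpt.differentiableAt.hasDerivAt.pow 2)
      convert! h3 using 1
      simp
    have h4 : 2 * (Real.exp t - 1) * phi t ^ 2
          + 2 * (Real.exp t - t - 1) * (2 * phi t * deriv phi t) = 2 * t := by
      rw [← h2.deriv, funext two_mul_exp_sub_mul_phi_sq]
      simp
    rw [h1, hdu, deriv_fun_pow hpt.differentiableAt]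
    have hk : (2 * k + 1 : ℝ) ≠ 0 := by positivity
    push_cast
    field_simp
    linear_combination (phi t ^ (2 * k + 1) / 2) * h4
      - (phi t ^ (2 * k) * deriv phi t) * two_mul_exp_sub_mul_phi_sq t
  rw [key.iteratedDeriv_eq, iteratedDeriv_fun_add (hphiA.fun_pow _).contDiffAt
    (analyticAt_const.fun_mul (analyticAt_id_mul hE)).contDiffAt, iteratedDeriv_const_mul_field,
    iteratedDeriv_id_mul_zero hE, show 2 * (k + 1) - 1 = 2 * k + 1 by omega,
    iteratedDeriv_euler_zero hP]
  simp

/-- For every `n ≥ 1`, `D^{2n}[φ^{2n+1}](0) = D^{2n}[Λ^{−n−1/2}](0)`; hence the Stirling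
coefficient also satisfies `γₙ = ((−1)ⁿ/(2ⁿ n!)) · D^{2n}[Λ^{−n−1/2}](0)` (the
Brassesco–Méndez representation). -/
theorem brassesco_mendez_equivalent (n : ℕ) (hn : 1 ≤ n) :
    iteratedDeriv (2 * n) (fun t => phi t ^ (2 * n + 1)) 0 =
      iteratedDeriv (2 * n) (fun z => Lam z ^ (-(n : ℝ) - 1 / 2)) 0 ∧
    stirlingGamma n = ((-1) ^ n / (2 ^ n * n.factorial)) *
      iteratedDeriv (2 * n) (fun z => Lam z ^ (-(n : ℝ) - 1 / 2)) 0 := by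
  have h := iteratedDeriv_phi_pow_eq n hn
  refine ⟨h, ?_⟩
  rw [stirlingGamma, if_neg (by omega), h]
end
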